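/- arXiv:2205.14866 — 2 statements merged into one kernel-verified Lean document; each statement's English description precedes it below -/
import Mathlib

section
/- Let d ≥ 1 be an integer and r ≥ 1 a real number. For all vectors a, b ∈ ℝ^d, | |a|^{r−1}a − |b|^{r−1}b | ≤ r(|a|^{r−1} + |b|^{r−1})|a − b|, where |·| is the Euclidean norm. -/
lemma aux_bernoulli (r : ℝ) (hr : 1 ≤ r) (A B : ℝ) (hA : 0 < A) (hB : 0 ≤ B) :
    (A ^ (r - 1) - B ^ (r - 1)) * B ≤ (r - 1) * A ^ (r - 1) * (A - B) := by
  have h := one_add_mul_self_le_rpow_one_add (s := B / A - 1)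
    (by have : 0 ≤ B / A := by positivity
        linarith) hr
  have e : 1 + (B / A - 1) = B / A := by ring
  rw [e, Real.div_rpow hB hA.le, le_div_iff₀ (by positivity)] at h
  have hAr : A ^ r = A ^ (r - 1) * A := by
    rw [← Real.rpow_add_one hA.ne']; congr 1; ring
  have hBr : B ^ r = B ^ (r - 1) * B := by
    rcases hB.eq_or_lt with h0 | h0
    · rw [← h0, Real.zero_rpow (by linarith)]; simp
    · rw [← Real.rpow_add_one h0.ne']; congr 1; ring
  rw [hAr, hBr] at h
  have e2 : (1 + r * (B / A - 1)) * (A ^ (r - 1) * A)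
      = A ^ (r - 1) * (A + r * (B - A)) := by
    field_simp
  rw [e2] at h
  linarith

lemma aux_main {E : Type*} [NormedAddCommGroup E] [NormedSpace ℝ E] (r : ℝ) (hr : 1 ≤ r)
    (a b : E) (hab : ‖b‖ ≤ ‖a‖) :
    ‖(‖a‖ ^ (r - 1)) • a - (‖b‖ ^ (r - 1)) • b‖ ≤
      r * (‖a‖ ^ (r - 1) + ‖b‖ ^ (r - 1)) * ‖a - b‖ := by
  rcases (norm_nonneg a).eq_or_lt with h0 | h0
  · have ha : a = 0 := norm_eq_zero.1 h0.symm
    have hb : b = 0 := norm_eq_zero.1 (le_antisymm (h0 ▸ hab) (norm_nonneg b))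
    simp [ha, hb]
  have hm : ‖b‖ ^ (r - 1) ≤ ‖a‖ ^ (r - 1) :=
    Real.rpow_le_rpow (norm_nonneg b) hab (by linarith)
  have e : (‖a‖ ^ (r - 1)) • a - (‖b‖ ^ (r - 1)) • b
      = (‖a‖ ^ (r - 1)) • (a - b) + (‖a‖ ^ (r - 1) - ‖b‖ ^ (r - 1)) • b := by
    module
  have hA : 0 ≤ ‖a‖ ^ (r - 1) := by positivity
  have hB : 0 ≤ r * ‖b‖ ^ (r - 1) * ‖a - b‖ := by positivity
  have h1 := aux_bernoulli r hr ‖a‖ ‖b‖ h0 (norm_nonneg b)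
  have h2 : (r - 1) * ‖a‖ ^ (r - 1) * (‖a‖ - ‖b‖) ≤ (r - 1) * ‖a‖ ^ (r - 1) * ‖a - b‖ :=
    mul_le_mul_of_nonneg_left (norm_sub_norm_le a b) (mul_nonneg (by linarith) hA)
  rw [e]
  refine (norm_add_le _ _).trans ?_
  rw [norm_smul, norm_smul, Real.norm_of_nonneg hA, Real.norm_of_nonneg (sub_nonneg.2 hm)]
  linarith


/-- Local Lipschitz-type estimate for `a ↦ |a|^{r-1} a` on `ℝ^d`. -/
theorem norm_rpow_smul_sub_le
    (d : ℕ) (hd : 1 ≤ d) (r : ℝ) (hr : 1 ≤ r)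
    (a b : EuclideanSpace ℝ (Fin d)) :
    ‖(‖a‖ ^ (r - 1)) • a - (‖b‖ ^ (r - 1)) • b‖ ≤
      r * (‖a‖ ^ (r - 1) + ‖b‖ ^ (r - 1)) * ‖a - b‖ := by
  rcases le_total ‖b‖ ‖a‖ with h | h
  · exact aux_main r hr a b h
  · have := aux_main r hr b a h
    rwa [norm_sub_rev, norm_sub_rev b a, add_comm (‖b‖ ^ (r - 1))] at this
end

section
/- (Ladyzhenskaya inequality in two dimensions.) Let u : ℝ² → ℝ² be continuously differentiable with compact support. Then (∫_{ℝ²} |u(x)|⁴ dx)^{1/4} ≤ 2^{1/4} (∫_{ℝ²} |u(x)|² dx)^{1/4} (∫_{ℝ²} |Du(x)|² dx)^{1/4}, where Du(x) is the total derivative (Jacobian) of u at x and |Du(x)| its Frobenius (Hilbert–Schmidt) norm; equivalently ∫|u|⁴ ≤ 2(∫|u|²)(∫|Du|²). -/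
open MeasureTheory Real

noncomputable section

abbrev E2 := EuclideanSpace ℝ (Fin 2)

/-- Standard basis vector of `ℝ²`. -/
def e2 (j : Fin 2) : E2 := EuclideanSpace.single j 1

/-- Squared Frobenius (Hilbert–Schmidt) norm of the Jacobian of `v` at `x`. -/
def frobSq (v : E2 → E2) (x : E2) : ℝ :=
  ∑ j : Fin 2, ‖fderiv ℝ v x (e2 j)‖ ^ 2

lemma lady_line (u : E2 → E2) (hu : ContDiff ℝ 1 u) (hsupp : HasCompactSupport u)
    (x e : E2) (he : ‖e‖ = 1) (r : ℝ) :
    ‖u (x + r • e)‖ ^ 2 ≤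
      ∫ s : ℝ, 2 * (‖u (x + s • e)‖ * ‖fderiv ℝ u (x + s • e) e‖) := by
  have hiso : Isometry (fun s : ℝ => x + s • e) := by
    refine Isometry.of_dist_eq fun a b => ?_
    simp [dist_eq_norm, ← sub_smul, norm_smul, he]
  have hce := hiso.isClosedEmbedding
  have hl : ContDiff ℝ 1 (fun s : ℝ => x + s • e) := by fun_prop
  have hφ : ContDiff ℝ 1 (fun s : ℝ => u (x + s • e)) := hu.comp hl
  have hφs : HasCompactSupport (fun s : ℝ => u (x + s • e)) :=
    hsupp.comp_isClosedEmbedding hce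
  have hd : ∀ s : ℝ, HasDerivAt (fun s : ℝ => u (x + s • e)) (fderiv ℝ u (x + s • e) e) s := by
    intro s
    have h1 : HasDerivAt (fun s : ℝ => x + s • e) e s := by
      simpa using ((hasDerivAt_id s).smul_const e).const_add x
    exact ((hu.differentiable (by norm_num)) (x + s • e)).hasFDerivAt.comp_hasDerivAt s h1
  have hh : ContDiff ℝ 1 (fun s : ℝ => ‖u (x + s • e)‖ ^ 2) := hφ.norm_sq ℝ
  have hhs : HasCompactSupport (fun s : ℝ => ‖u (x + s • e)‖ ^ 2) :=
    hφs.comp_left (g := fun v : E2 => ‖v‖ ^ 2) (by simp)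
  have hb : ∀ s : ℝ, ‖deriv (fun s : ℝ => ‖u (x + s • e)‖ ^ 2) s‖ ≤
      2 * (‖u (x + s • e)‖ * ‖fderiv ℝ u (x + s • e) e‖) := by
    intro s
    rw [((hd s).norm_sq).deriv, norm_mul, Real.norm_two]
    gcongr
    exact norm_inner_le_norm _ _
  have hcont : Continuous (fun s : ℝ => 2 * (‖u (x + s • e)‖ * ‖fderiv ℝ u (x + s • e) e‖)) := by
    have := hu.continuous
    have := hu.continuous_fderiv (by norm_num)
    fun_prop
  have hint : Integrable
      (fun s : ℝ => 2 * (‖u (x + s • e)‖ * ‖fderiv ℝ u (x + s • e) e‖)) := by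
    refine hcont.integrable_of_hasCompactSupport ?_
    exact (hφs.norm.mul_right).mul_left
  have hdint : Integrable (deriv (fun s : ℝ => ‖u (x + s • e)‖ ^ 2)) :=
    (hh.continuous_deriv (by norm_num)).integrable_of_hasCompactSupport hhs.deriv
  calc ‖u (x + r • e)‖ ^ 2 = ∫ s in Set.Iic r, deriv (fun s : ℝ => ‖u (x + s • e)‖ ^ 2) s :=
        (hhs.integral_Iic_deriv_eq hh r).symm
    _ ≤ ∫ s in Set.Iic r, ‖deriv (fun s : ℝ => ‖u (x + s • e)‖ ^ 2) s‖ :=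
        (Real.le_norm_self _).trans (norm_integral_le_integral_norm _)
    _ ≤ ∫ s, ‖deriv (fun s : ℝ => ‖u (x + s • e)‖ ^ 2) s‖ :=
        setIntegral_le_integral hdint.norm (Filter.Eventually.of_forall fun _ => norm_nonneg _)
    _ ≤ _ := integral_mono hdint.norm hint hb

lemma lady_prod (f g₁ g₂ : ℝ × ℝ → ℝ) (hf : ∀ p, 0 ≤ f p)
    (hfi : Integrable (fun p => f p ^ 2)) (h₁ : Integrable g₁) (h₂ : Integrable g₂)
    (hb₁ : ∀ s t, f (s, t) ≤ ∫ x, g₁ (x, t)) (hb₂ : ∀ s t, f (s, t) ≤ ∫ y, g₂ (s, y)) :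
    ∫ p, f p ^ 2 ≤ (∫ p, g₁ p) * ∫ p, g₂ p := by
  have i₁ : Integrable (fun t : ℝ => ∫ x : ℝ, g₁ (x, t)) := h₁.integral_prod_right
  have i₂ : Integrable (fun s : ℝ => ∫ y : ℝ, g₂ (s, y)) := h₂.integral_prod_left
  calc ∫ p, f p ^ 2
      ≤ ∫ p : ℝ × ℝ, (∫ y : ℝ, g₂ (p.1, y)) * (∫ x : ℝ, g₁ (x, p.2)) := by
        refine integral_mono hfi (i₂.mul_prod i₁) fun p => ?_
        show f p ^ 2 ≤ _
        rw [sq]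
        exact mul_le_mul (hb₂ p.1 p.2) (hb₁ p.1 p.2) (hf p) ((hf p).trans (hb₂ p.1 p.2))
    _ = (∫ s : ℝ, ∫ y : ℝ, g₂ (s, y)) * ∫ t : ℝ, ∫ x : ℝ, g₁ (x, t) :=
        integral_prod_mul (μ := (volume : Measure ℝ)) (ν := (volume : Measure ℝ))
          (fun s => ∫ y : ℝ, g₂ (s, y)) (fun t => ∫ x : ℝ, g₁ (x, t))
    _ = (∫ p, g₁ p) * ∫ p, g₂ p := by
        rw [mul_comm]
        congr 1
        · exact (integral_prod_symm g₁ h₁).symm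
        · exact (integral_prod g₂ h₂).symm

lemma lady_cs (a b : E2 → ℝ) (ha : Integrable (fun x => a x ^ 2))
    (hb : Integrable (fun x => b x ^ 2)) (hab : Integrable (fun x => a x * b x)) :
    (∫ x, a x * b x) ^ 2 ≤ (∫ x, a x ^ 2) * ∫ x, b x ^ 2 := by
  have key : ∀ c : ℝ, 0 ≤ (∫ x, b x ^ 2) * (c * c) + (-2 * ∫ x, a x * b x) * c
      + ∫ x, a x ^ 2 := by
    intro c
    have : ∫ x, (a x - c * b x) ^ 2 = (∫ x, b x ^ 2) * (c * c) + (-2 * ∫ x, a x * b x) * c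
      + ∫ x, a x ^ 2 := by
      have e : (fun x => (a x - c * b x) ^ 2) =
          fun x => ((c * c) * b x ^ 2 + (-2 * c) * (a x * b x)) + a x ^ 2 := by
        funext x; ring
      have i : Integrable (fun x => (c * c) * b x ^ 2 + (-2 * c) * (a x * b x)) :=
        (hb.const_mul _).add (hab.const_mul _)
      rw [e, integral_add i ha,
        integral_add (hb.const_mul _) (hab.const_mul _), integral_const_mul, integral_const_mul]
      ring
    rw [← this]
    exact integral_nonneg fun x => sq_nonneg _
  have := discrim_le_zero key
  unfold discrim at this
  nlinarith

def ladyT : ℝ × ℝ ≃ᵐ E2 := MeasurableEquiv.finTwoArrow.symm.trans (MeasurableEquiv.toLp 2 (Fin 2 → ℝ))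

lemma ladyT_mp : MeasurePreserving ladyT :=
  (PiLp.volume_preserving_toLp (Fin 2)).comp ((volume_preserving_finTwoArrow ℝ).symm _)

lemma ladyT_eq0 (s t : ℝ) : ladyT (s, t) = ladyT (0, t) + s • e2 0 := by
  ext i; fin_cases i <;> simp [ladyT, e2]

lemma ladyT_eq1 (s t : ℝ) : ladyT (s, t) = ladyT (s, 0) + t • e2 1 := by
  ext i; fin_cases i <;> simp [ladyT, e2]

lemma lady_main (u : E2 → E2) (hu : ContDiff ℝ 1 u) (hsupp : HasCompactSupport u) :
    ∫ x, ‖u x‖ ^ 4 ≤ 2 * (∫ x, ‖u x‖ ^ 2) * ∫ x, frobSq u x := by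
  have c0 := hu.continuous
  have c1 := hu.continuous_fderiv (by norm_num)
  have hn : ∀ j, ‖e2 j‖ = 1 := by intro j; simp [e2]
  have iu : ∀ n : ℕ, n ≠ 0 → Integrable (fun x => ‖u x‖ ^ n) := fun n hn =>
    Continuous.integrable_of_hasCompactSupport (by fun_prop)
      (hsupp.comp_left (g := fun v : E2 => ‖v‖ ^ n) (by simp [hn]))
  have iD : ∀ j, Integrable (fun x => ‖fderiv ℝ u x (e2 j)‖ ^ 2) := fun j =>
    Continuous.integrable_of_hasCompactSupport (by fun_prop)
      ((hsupp.fderiv (𝕜 := ℝ)).comp_left (g := fun L : E2 →L[ℝ] E2 => ‖L (e2 j)‖ ^ 2) (by simp))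
  have im : ∀ j, Integrable (fun x => ‖u x‖ * ‖fderiv ℝ u x (e2 j)‖) := fun j =>
    Continuous.integrable_of_hasCompactSupport (by fun_prop) hsupp.norm.mul_right
  have tr : ∀ f : E2 → ℝ, ∫ p, f (ladyT p) = ∫ x, f x := fun f => ladyT_mp.integral_comp' f
  have ti : ∀ f : E2 → ℝ, Integrable f → Integrable (fun p => f (ladyT p)) := fun f hf =>
    ladyT_mp.integrable_comp_of_integrable hf
  have e4 : ∀ x, (‖u x‖ ^ 2) ^ 2 = ‖u x‖ ^ 4 := fun x => by ring
  have P := lady_prod (fun p => ‖u (ladyT p)‖ ^ 2)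
    (fun p => 2 * (‖u (ladyT p)‖ * ‖fderiv ℝ u (ladyT p) (e2 0)‖))
    (fun p => 2 * (‖u (ladyT p)‖ * ‖fderiv ℝ u (ladyT p) (e2 1)‖))
    (fun p => by positivity)
    (by simp only [e4]; exact ti _ (iu 4 (by norm_num)))
    (ti _ ((im 0).const_mul 2)) (ti _ ((im 1).const_mul 2))
    (fun s t => by
      have := lady_line u hu hsupp (ladyT (0, t)) (e2 0) (hn 0) s
      simpa only [← ladyT_eq0] using this)
    (fun s t => by
      have := lady_line u hu hsupp (ladyT (s, 0)) (e2 1) (hn 1) t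
      simpa only [← ladyT_eq1] using this)
  simp only [e4] at P
  rw [tr (fun x => ‖u x‖ ^ 4), tr (fun x => 2 * (‖u x‖ * ‖fderiv ℝ u x (e2 0)‖)),
    tr (fun x => 2 * (‖u x‖ * ‖fderiv ℝ u x (e2 1)‖)), integral_const_mul, integral_const_mul] at P
  have C0 := lady_cs _ _ (iu 2 (by norm_num)) (iD 0) (im 0)
  have C1 := lady_cs _ _ (iu 2 (by norm_num)) (iD 1) (im 1)
  have F : ∫ x, frobSq u x = (∫ x, ‖fderiv ℝ u x (e2 0)‖ ^ 2) +
      ∫ x, ‖fderiv ℝ u x (e2 1)‖ ^ 2 := by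
    simp only [frobSq, Fin.sum_univ_two]
    exact integral_add (iD 0) (iD 1)
  rw [F]
  nlinarith [sq_nonneg ((∫ x, ‖u x‖ * ‖fderiv ℝ u x (e2 0)‖) -
    ∫ x, ‖u x‖ * ‖fderiv ℝ u x (e2 1)‖)]

/-- Ladyzhenskaya's inequality in two dimensions for `C¹` compactly supported
vector fields `u : ℝ² → ℝ²`:
`(∫ |u|⁴)^{1/4} ≤ 2^{1/4} (∫ |u|²)^{1/4} (∫ |Du|²)^{1/4}`. -/
theorem ladyzhenskaya_two_dim
    (u : E2 → E2) (hu : ContDiff ℝ 1 u) (hsupp : HasCompactSupport u) :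
    (∫ x, ‖u x‖ ^ 4) ^ ((1 : ℝ) / 4) ≤
      (2 : ℝ) ^ ((1 : ℝ) / 4) * (∫ x, ‖u x‖ ^ 2) ^ ((1 : ℝ) / 4) *
        (∫ x, frobSq u x) ^ ((1 : ℝ) / 4) := by
  have h2 : 0 ≤ ∫ x, ‖u x‖ ^ 2 := integral_nonneg fun x => by positivity
  have h3 : 0 ≤ ∫ x, frobSq u x := integral_nonneg fun x => by
    unfold frobSq; positivity
  rw [← Real.mul_rpow (by norm_num) h2, ← Real.mul_rpow (by positivity) h3]
  exact Real.rpow_le_rpow (integral_nonneg fun x => by positivity)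
    (lady_main u hu hsupp) (by norm_num)

end
end
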